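/- There exists a positive, discrete, translation bounded, almost periodic Radon measure μ on ℝ such that μ({λ}) → 0 as |λ| → ∞ for λ ∈ supp μ. In particular, the almost periodic measures μ and 2μ satisfy: their supports coincide, and the differences of their point masses tend to 0 at infinity, yet μ ≠ 2μ. -/

import Mathlib

open MeasureTheory Filter
open scoped ENNReal

/-- Bohr almost periodicity of a real-valued function on `ℝ`. -/
def BohrAlmostPeriodic (g : ℝ → ℝ) : Prop :=
  ∀ ε > (0 : ℝ), ∃ L > (0 : ℝ), ∀ a : ℝ,
    ∃ τ ∈ Set.Icc a (a + L), ∀ x : ℝ, |g (x + τ) - g x| < ε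


namespace APConstr

noncomputable def dig (k : ℕ) (n : ℤ) : ℝ :=
  if n.bmod (2 ^ (k + 1)) ≠ n.bmod (2 ^ k) then 1 else 0

noncomputable def stp (k : ℕ) (u : ℝ) : ℝ := (⌊(2 : ℝ) ^ k * Int.fract u⌋ : ℝ) / 2 ^ k

noncomputable def term (n : ℤ) (u : ℝ) (k : ℕ) : ℝ := dig k n * stp k u * ((1 / 2) ^ k * (1 / 4))

noncomputable def phi (n : ℤ) (u : ℝ) : ℝ := ∑' k, term n u k

lemma dig_nonneg (k n) : 0 ≤ dig k n := by unfold dig; split_ifs <;> norm_num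
lemma dig_le (k n) : dig k n ≤ 1 := by unfold dig; split_ifs <;> norm_num

lemma stp_nonneg (k u) : 0 ≤ stp k u := by
  unfold stp
  have : (0 : ℤ) ≤ ⌊(2 : ℝ) ^ k * Int.fract u⌋ :=
    Int.floor_nonneg.2 (mul_nonneg (by positivity) (Int.fract_nonneg u))
  have h : (0 : ℝ) ≤ (⌊(2 : ℝ) ^ k * Int.fract u⌋ : ℝ) := by exact_mod_cast this
  positivity

lemma stp_le (k u) : stp k u ≤ 1 := by
  unfold stp
  rw [div_le_one (by positivity)]
  refine (Int.floor_le _).trans ?_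
  have := (Int.fract_lt_one u).le
  have h2 : (0 : ℝ) < 2 ^ k := by positivity
  nlinarith

lemma term_nonneg (n u k) : 0 ≤ term n u k := by
  have := dig_nonneg k n
  have := stp_nonneg k u
  unfold term; positivity

lemma term_le (n u k) : term n u k ≤ (1 / 2) ^ k * (1 / 4) := by
  have h1 := dig_nonneg k n
  have h2 := stp_nonneg k u
  have h3 := mul_le_one₀ (dig_le k n) h2 (stp_le k u)
  unfold term
  exact mul_le_of_le_one_left (by positivity) h3

lemma summable_bd : Summable (fun k : ℕ => ((1 : ℝ) / 2) ^ k * (1 / 4)) :=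
  summable_geometric_two.mul_right _

lemma summable_term (n u) : Summable (term n u) :=
  Summable.of_nonneg_of_le (term_nonneg n u) (term_le n u) summable_bd

lemma phi_nonneg (n u) : 0 ≤ phi n u := tsum_nonneg (term_nonneg n u)

lemma phi_le (n u) : phi n u ≤ 1 / 2 := by
  have := (summable_term n u).tsum_le_tsum (term_le n u) summable_bd
  rw [tsum_mul_right, tsum_geometric_two] at this
  unfold phi; linarith

lemma dig_add (j k : ℕ) (h : j < k) (n m : ℤ) : dig j (n + 2 ^ k * m) = dig j n := by
  have key : ∀ i ≤ k, (n + 2 ^ k * m).bmod (2 ^ i) = n.bmod (2 ^ i) := by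
    intro i hi
    have : (n + 2 ^ k * m) = n + ((2 ^ i : ℕ) : ℤ) * (2 ^ (k - i) * m) := by
      push_cast
      rw [← mul_assoc, ← pow_add, Nat.add_sub_cancel' hi]
    rw [this, Int.add_mul_bmod_self_left]
  unfold dig
  rw [key _ (by omega), key _ (by omega)]

lemma phi_split (n u) (k : ℕ) : ∃ t, phi n u = ∑ i ∈ Finset.range k, term n u i + t ∧ 0 ≤ t ∧
    t ≤ (1 / 2) ^ k := by
  refine ⟨∑' i, term n u (i + k), ((summable_term n u).sum_add_tsum_nat_add k).symm,
    tsum_nonneg fun i => term_nonneg _ _ _, ?_⟩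
  have hs : Summable (fun i : ℕ => ((1 : ℝ) / 2) ^ i * ((1 / 2) ^ k * (1 / 4))) :=
    summable_geometric_two.mul_right _
  have := ((summable_nat_add_iff k).2 (summable_term n u)).tsum_le_tsum
    (g := fun i : ℕ => ((1 : ℝ) / 2) ^ i * ((1 / 2) ^ k * (1 / 4)))
    (fun i => (term_le n u (i + k)).trans (by rw [pow_add]; ring_nf; rfl)) hs
  rw [tsum_mul_right, tsum_geometric_two] at this
  have h0 : (0 : ℝ) < (1 / 2) ^ k := by positivity
  linarith

lemma phi_ap (k : ℕ) (n m : ℤ) (u : ℝ) : |phi (n + 2 ^ k * m) u - phi n u| ≤ (1 / 2) ^ k := by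
  obtain ⟨t, h1, h2, h3⟩ := phi_split n u k
  obtain ⟨s, g1, g2, g3⟩ := phi_split (n + 2 ^ k * m) u k
  have : ∑ i ∈ Finset.range k, term (n + 2 ^ k * m) u i = ∑ i ∈ Finset.range k, term n u i := by
    refine Finset.sum_congr rfl fun i hi => ?_
    unfold term
    rw [dig_add i k (Finset.mem_range.1 hi)]
  rw [g1, h1, this, abs_le]
  constructor <;> linarith

lemma bmod_big (n : ℤ) (k : ℕ) (h : n.natAbs < k) : n.bmod (2 ^ k) = n := by
  obtain ⟨j, rfl⟩ : ∃ j, k = j + 1 := ⟨k - 1, by omega⟩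
  have h1 : j < 2 ^ j := Nat.lt_two_pow_self
  apply Int.bmod_eq_of_le
  · push_cast; rw [pow_succ]; zify at h1; omega
  · push_cast; rw [pow_succ]; zify at h1; omega

lemma dig_big (n : ℤ) (k : ℕ) (h : n.natAbs < k) : dig k n = 0 := by
  unfold dig
  rw [bmod_big n k h, bmod_big n (k + 1) (by omega)]
  simp

lemma phi_eq (n u) : phi n u = ∑ i ∈ Finset.range (n.natAbs + 1), term n u i := by
  refine tsum_eq_sum fun i hi => ?_
  unfold term
  rw [dig_big n i (by simpa [Nat.lt_succ_iff] using hi)]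
  simp

lemma stp_meas (k) : Measurable (stp k) := by
  unfold stp
  have : Measurable (fun u : ℝ => ⌊(2 : ℝ) ^ k * Int.fract u⌋) :=
    Int.measurable_floor.comp (measurable_fract.const_mul _)
  exact (measurable_from_top.comp this).div_const _

lemma phi_meas (n) : Measurable (phi n) := by
  have : phi n = fun u => ∑ i ∈ Finset.range (n.natAbs + 1), term n u i := funext (phi_eq n)
  rw [this]
  refine Finset.measurable_sum _ fun i _ => ?_
  unfold term
  exact ((stp_meas i).const_mul _).mul_const _

lemma stp_fin (k) : (Set.range (stp k)).Finite := by
  refine ((Set.finite_Icc (0 : ℤ) (2 ^ k)).image (fun z : ℤ => (z : ℝ) / 2 ^ k)).subset ?_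
  rintro _ ⟨u, rfl⟩
  refine ⟨⌊(2 : ℝ) ^ k * Int.fract u⌋, ⟨?_, ?_⟩, rfl⟩
  · exact Int.floor_nonneg.2 (mul_nonneg (by positivity) (Int.fract_nonneg u))
  · have := stp_le k u
    unfold stp at this
    rw [div_le_one (by positivity)] at this
    exact_mod_cast this

lemma phi_fin (n) : (Set.range (phi n)).Finite := by
  have : phi n = fun u => ∑ i ∈ Finset.range (n.natAbs + 1), term n u i := funext (phi_eq n)
  rw [this]
  generalize n.natAbs + 1 = K
  induction K with
  | zero => simpa using (Set.finite_singleton (0 : ℝ)).subset (Set.range_const_subset)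
  | succ K ih =>
    refine (Set.Finite.image2 (fun a b => a + dig K n * b * ((1 / 2) ^ K * (1 / 4)))
      ih (stp_fin K)).subset ?_
    rintro _ ⟨u, rfl⟩
    refine ⟨_, ⟨u, rfl⟩, _, ⟨u, rfl⟩, ?_⟩
    simp only [Finset.sum_range_succ, term]

lemma exists_dig (n : ℤ) (hn : n ≠ 0) : ∃ k : ℕ, dig k n = 1 ∧ n.natAbs ≤ 2 ^ k := by
  classical
  have hex : ∃ K : ℕ, n.bmod (2 ^ K) = n := ⟨_, bmod_big n (n.natAbs + 1) (by omega)⟩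
  have h1 := Nat.find_spec hex
  have h2 := fun k => Nat.find_min hex (m := k)
  generalize Nat.find hex = K at h1 h2
  cases K with
  | zero => simp at h1; exact absurd h1.symm hn
  | succ k =>
    have h3 := h2 k (by omega)
    refine ⟨k, ?_, ?_⟩
    · unfold dig
      rw [if_pos]
      rw [h1]; exact fun h => h3 h.symm
    · have a := Int.le_bmod (x := n) (m := 2 ^ (k + 1)) (by positivity)
      have b := Int.bmod_le (x := n) (m := 2 ^ (k + 1)) (by positivity)
      rw [h1] at a b
      push_cast at a b
      rw [pow_succ] at a b
      zify
      rw [abs_le]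
      constructor <;> omega

lemma stp_mono (k) {u v : ℝ} (h : Int.fract u ≤ Int.fract v) : stp k u ≤ stp k v := by
  unfold stp
  gcongr

lemma phi_inj {n : ℤ} {k : ℕ} (hk : dig k n = 1) {u v : ℝ} (h : phi n u = phi n v) :
    stp k u = stp k v := by
  wlog huv : Int.fract u ≤ Int.fract v generalizing u v
  · exact (this h.symm (le_of_not_ge huv)).symm
  by_contra hne
  have hlt := lt_of_le_of_ne (stp_mono k huv) hne
  have : phi n u < phi n v := by
    refine Summable.tsum_lt_tsum (i := k) ?_ ?_ (summable_term n u) (summable_term n v)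
    · intro j
      have := dig_nonneg j n
      have := stp_mono j huv
      simp only [term]
      gcongr
    · simp only [term, hk]
      gcongr
  exact this.ne h

noncomputable abbrev P : Measure ℝ := volume.restrict (Set.Ico (0 : ℝ) 1)

instance : IsProbabilityMeasure P := ⟨by simp [P]⟩

lemma phi_atom (n : ℤ) (hn : n ≠ 0) (y : ℝ) :
    P (phi n ⁻¹' {y}) ≤ ENNReal.ofReal (1 / |(n : ℝ)|) := by
  obtain ⟨k, hk, hnk⟩ := exists_dig n hn
  rw [Measure.restrict_apply (phi_meas n (measurableSet_singleton y))]
  by_cases hv : (phi n ⁻¹' {y}).Nonempty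
  swap
  · rw [Set.not_nonempty_iff_eq_empty.1 hv]; simp
  obtain ⟨v, hv⟩ := hv
  set a := ⌊(2 : ℝ) ^ k * Int.fract v⌋ with ha
  have h2 : (0 : ℝ) < 2 ^ k := by positivity
  have hsub : phi n ⁻¹' {y} ∩ Set.Ico 0 1 ⊆ Set.Ico ((a : ℝ) / 2 ^ k) ((a + 1) / 2 ^ k) := by
    rintro u ⟨hu, hu1⟩
    have h := phi_inj hk (u := u) (v := v) (by rw [hu, hv])
    unfold stp at h
    rw [div_left_inj' h2.ne', ← ha, Int.fract_eq_self.2 hu1] at h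
    rw [← h]
    constructor
    · rw [div_le_iff₀ h2, mul_comm]; exact Int.floor_le _
    · rw [lt_div_iff₀ h2, mul_comm]; exact Int.lt_floor_add_one _
  refine (measure_mono hsub).trans ?_
  rw [Real.volume_Ico]
  apply ENNReal.ofReal_le_ofReal
  have : ((a : ℝ) + 1) / 2 ^ k - a / 2 ^ k = 1 / 2 ^ k := by ring
  rw [this]
  have hn' : 0 < |(n : ℝ)| := by simpa using hn
  apply one_div_le_one_div_of_le hn'
  have : ((n.natAbs : ℕ) : ℝ) ≤ 2 ^ k := by exact_mod_cast hnk
  rwa [Nat.cast_natAbs, Int.cast_abs] at this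

noncomputable def nu (n : ℤ) : Measure ℝ := P.map (fun u => (n : ℝ) + phi n u)

noncomputable def mu : Measure ℝ := Measure.sum nu

lemma meas_n (n : ℤ) : Measurable (fun u => (n : ℝ) + phi n u) := (phi_meas n).const_add _

instance (n : ℤ) : IsProbabilityMeasure (nu n) :=
  Measure.isProbabilityMeasure_map (meas_n n).aemeasurable

lemma nu_zero (n : ℤ) (s : Set ℝ) (hs : MeasurableSet s)
    (h : ∀ u, (n : ℝ) + phi n u ∉ s) : nu n s = 0 := by
  unfold nu
  rw [Measure.map_apply (meas_n n) hs]
  have : (fun u => (n : ℝ) + phi n u) ⁻¹' s = ∅ := by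
    ext u; simpa using h u
  rw [this]; simp

lemma mu_bdd (t : ℝ) : mu (Set.Icc t (t + 1)) ≤ 3 := by
  unfold mu
  rw [Measure.sum_apply _ measurableSet_Icc]
  rw [tsum_eq_sum (s := Finset.Icc ⌈t - 1⌉ ⌊t + 1⌋)]
  · refine (Finset.sum_le_card_nsmul _ _ 1 fun n _ => prob_le_one).trans ?_
    rw [Int.card_Icc, nsmul_eq_mul, mul_one]
    have : (⌊t + 1⌋ + 1 - ⌈t - 1⌉).toNat ≤ 3 := by
      have h1 := Int.floor_le (t + 1)
      have h2 := Int.le_ceil (t - 1)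
      have : ((⌊t + 1⌋ - ⌈t - 1⌉ : ℤ) : ℝ) ≤ (2 : ℤ) := by push_cast; linarith
      have := Int.cast_le.1 this
      omega
    exact_mod_cast this
  · intro n hn
    refine nu_zero n _ measurableSet_Icc fun u hu => hn ?_
    have h1 := phi_nonneg n u
    have h2 := phi_le n u
    rw [Finset.mem_Icc, Int.ceil_le, Int.le_floor]
    constructor <;> linarith [hu.1, hu.2]

instance : IsLocallyFiniteMeasure mu := by
  refine ⟨fun x => ⟨Set.Icc (x - 1 / 2) (x - 1 / 2 + 1), Icc_mem_nhds (by linarith) (by linarith),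
    (mu_bdd _).trans_lt (by norm_num)⟩⟩

lemma mu_atom (x : ℝ) : mu {x} ≤ P (phi ⌊x⌋ ⁻¹' {Int.fract x}) := by
  unfold mu
  rw [Measure.sum_apply _ (measurableSet_singleton x), tsum_eq_single ⌊x⌋]
  · unfold nu
    rw [Measure.map_apply (meas_n _) (measurableSet_singleton x)]
    refine measure_mono fun u hu => ?_
    simp only [Set.mem_preimage, Set.mem_singleton_iff] at hu ⊢
    rw [Int.fract]; linarith
  · intro n hn
    refine nu_zero n _ (measurableSet_singleton x) fun u hu => hn ?_
    have h1 := phi_nonneg n u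
    have h2 := phi_le n u
    rw [Set.mem_singleton_iff] at hu
    rw [eq_comm, Int.floor_eq_iff]
    constructor <;> linarith

lemma mu_tendsto : Tendsto (fun x : ℝ => mu {x}) (cocompact ℝ) (nhds 0) := by
  have hn := tendsto_norm_cocompact_atTop (E := ℝ)
  have h1 : Tendsto (fun x : ℝ => ENNReal.ofReal (1 / (‖x‖ - 1))) (cocompact ℝ) (nhds 0) := by
    rw [← ENNReal.ofReal_zero]
    refine ENNReal.tendsto_ofReal ?_
    simp only [one_div]
    exact tendsto_inv_atTop_zero.comp (tendsto_atTop_add_const_right _ (-1) hn)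
  refine tendsto_of_tendsto_of_tendsto_of_le_of_le' tendsto_const_nhds h1
    (Eventually.of_forall fun _ => zero_le) ?_
  filter_upwards [hn.eventually_ge_atTop 2] with x hx
  rw [Real.norm_eq_abs] at hx ⊢
  have hfl : |x| - 1 ≤ |(⌊x⌋ : ℝ)| := by
    have e : x = ⌊x⌋ + Int.fract x := (Int.floor_add_fract x).symm
    have h3 : |Int.fract x| ≤ 1 := by
      rw [abs_of_nonneg (Int.fract_nonneg x)]; exact (Int.fract_lt_one x).le
    have := abs_add_le (⌊x⌋ : ℝ) (Int.fract x)
    rw [← e] at this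
    linarith
  have h0 : ⌊x⌋ ≠ 0 := by
    intro h
    rw [h] at hfl
    simp at hfl
    linarith
  refine (mu_atom x).trans ((phi_atom _ h0 _).trans ?_)
  apply ENNReal.ofReal_le_ofReal
  exact one_div_le_one_div_of_le (by linarith) hfl

lemma mu_ne : mu ≠ (2 : ℝ≥0∞) • mu := by
  intro h
  have h1 : mu (Set.Icc 0 (0 + 1)) ≠ ⊤ := ((mu_bdd 0).trans_lt (by norm_num)).ne
  have h2 : mu (Set.Icc 0 (0 + 1)) ≠ 0 := by
    intro h0
    have : nu 0 (Set.Icc 0 (0 + 1)) ≤ mu (Set.Icc 0 (0 + 1)) := Measure.le_sum nu 0 _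
    rw [h0] at this
    have h4 : nu 0 (Set.Icc 0 (0 + 1)) = 1 := by
      unfold nu
      rw [Measure.map_apply (meas_n _) measurableSet_Icc]
      rw [← measure_univ (μ := P)]
      congr 1
      ext u
      have := phi_nonneg 0 u
      have := phi_le 0 u
      simp only [Set.mem_preimage, Set.mem_Icc, Set.mem_univ, iff_true]
      constructor <;> push_cast <;> linarith
    rw [h4] at this
    simp at this
  have h3 := congrArg (fun m : Measure ℝ => m (Set.Icc 0 (0 + 1))) h
  simp only [Measure.smul_apply, smul_eq_mul] at h3
  rw [two_mul] at h3
  generalize mu (Set.Icc 0 (0 + 1)) = a at *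
  exact h2 ((ENNReal.add_right_inj h1).1 (h3.symm.trans (add_zero a).symm))

/-- carrier -/
def car : Set ℝ := ⋃ n : ℤ, Set.range (fun u => (n : ℝ) + phi n u)

lemma car_fin (n : ℤ) : (Set.range (fun u => (n : ℝ) + phi n u)).Finite := by
  have := (phi_fin n).image (fun y => (n : ℝ) + y)
  rwa [← Set.range_comp] at this

lemma car_countable : car.Countable := Set.countable_iUnion fun n => (car_fin n).countable

lemma car_loc (l : ℝ) : (car ∩ Set.Icc (l - 1) (l + 1)).Finite := by
  refine ((Set.finite_Icc ⌈l - 2⌉ ⌊l + 1⌋).biUnion fun n _ => car_fin n).subset ?_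
  rintro x ⟨hx, hx1⟩
  obtain ⟨n, u, rfl⟩ := Set.mem_iUnion.1 hx
  refine Set.mem_biUnion (x := n) ?_ ⟨u, rfl⟩
  have h1 := phi_nonneg n u
  have h2 := phi_le n u
  simp only [Set.mem_Icc] at hx1
  rw [Set.mem_Icc, Int.ceil_le, Int.le_floor]
  constructor <;> linarith [hx1.1, hx1.2]

lemma mu_car : mu carᶜ = 0 := by
  unfold mu
  have hm : MeasurableSet carᶜ := car_countable.measurableSet.compl
  rw [Measure.sum_apply _ hm]
  refine ENNReal.tsum_eq_zero.2 fun n => nu_zero n _ hm fun u hu => hu ?_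
  exact Set.mem_iUnion.2 ⟨n, u, rfl⟩

lemma mu_discrete : ∃ Λ : Set ℝ,
        mu ((Λ : Set ℝ)ᶜ) = 0 ∧
        (∀ l ∈ Λ, ∃ ε > (0 : ℝ), Λ ∩ Set.Ioo (l - ε) (l + ε) = {l}) ∧
        (∀ l ∈ Λ, mu {l} ≠ 0) := by
  have hsub : {l : ℝ | mu {l} ≠ 0} ⊆ car := by
    intro l hl
    by_contra h
    exact hl (measure_mono_null (Set.singleton_subset_iff.2 h) mu_car)
  refine ⟨{l | mu {l} ≠ 0}, ?_, ?_, fun l hl => hl⟩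
  · have : ({l : ℝ | mu {l} ≠ 0})ᶜ ⊆ carᶜ ∪ ⋃ l ∈ car ∩ {l : ℝ | mu {l} = 0}, {l} := by
      intro x hx
      simp at hx ⊢
      tauto
    refine measure_mono_null this (measure_union_null mu_car ?_)
    rw [measure_biUnion_null_iff (car_countable.mono Set.inter_subset_left)]
    exact fun i hi => hi.2
  · intro l hl
    have hf : ((car ∩ Set.Icc (l - 1) (l + 1)) \ {l}).Finite := (car_loc l).subset Set.sdiff_subset
    have hn : ((car ∩ Set.Icc (l - 1) (l + 1)) \ {l})ᶜ ∈ nhds l :=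
      hf.isClosed.isOpen_compl.mem_nhds (by simp)
    obtain ⟨ε, hε, hb⟩ := Metric.mem_nhds_iff.1 hn
    refine ⟨min ε 1, by positivity, ?_⟩
    ext x
    constructor
    · rintro ⟨hx, hx1, hx2⟩
      by_contra hne
      have i1 := min_le_left ε 1
      have i2 := min_le_right ε 1
      refine hb (a := x) ?_ ⟨⟨hsub hx, ?_, ?_⟩, hne⟩
      · rw [Metric.mem_ball, Real.dist_eq, abs_lt]; constructor <;> linarith
      · linarith
      · linarith
    · rintro rfl
      have : 0 < min ε 1 := by positivity
      exact ⟨hl, by linarith, by linarith⟩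

lemma mu_integral (f : ℝ → ℝ) (hf : Continuous f) (hc : HasCompactSupport f) (x : ℝ) :
    ∫ y, f (x - y) ∂mu = ∑' n : ℤ, ∫ u, f (x - (n + phi n u)) ∂P := by
  have hi : Integrable (fun y => f (x - y)) mu := by
    refine Continuous.integrable_of_hasCompactSupport (by fun_prop) ?_
    exact hc.comp_homeomorph (Homeomorph.subLeft x)
  unfold mu at hi ⊢
  rw [integral_sum_measure hi]
  congr 1
  ext n
  unfold nu
  rw [integral_map (meas_n n).aemeasurable]
  exact (by fun_prop : Continuous fun y => f (x - y)).aestronglyMeasurable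

lemma mu_ap (f : ℝ → ℝ) (hf : Continuous f) (hc : HasCompactSupport f) :
    BohrAlmostPeriodic (fun x => ∫ y, f (x - y) ∂mu) := by
  intro ε hε
  obtain ⟨R, hR0, hR⟩ : ∃ R : ℝ, 0 < R ∧ ∀ z, f z ≠ 0 → |z| ≤ R := by
    obtain ⟨R, h⟩ := hc.isCompact.isBounded.exists_norm_le
    refine ⟨max R 1, by positivity, fun z hz => ?_⟩
    exact (h z (subset_tsupport f hz)).trans (le_max_left _ _)
  set C := 2 * R + 3 with hC
  have hC0 : 0 < C := by positivity
  obtain ⟨δ, hδ, huc⟩ := Metric.uniformContinuous_iff.1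
    (hc.uniformContinuous_of_continuous hf) (ε / C) (by positivity)
  obtain ⟨k, hk⟩ := exists_pow_lt_of_lt_one hδ (by norm_num : (1 : ℝ) / 2 < 1)
  have hp : (0 : ℝ) < 2 ^ k := by positivity
  refine ⟨2 ^ k, hp, fun a => ?_⟩
  set m := ⌈a / 2 ^ k⌉ with hm
  refine ⟨2 ^ k * m, ⟨?_, ?_⟩, fun x => ?_⟩
  · have := Int.le_ceil (a / 2 ^ k)
    rw [div_le_iff₀ hp] at this
    linarith
  · have := (Int.ceil_lt_add_one (a / 2 ^ k)).le
    have h := mul_le_mul_of_nonneg_left this hp.le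
    rw [mul_add, mul_div_cancel₀ _ hp.ne'] at h
    linarith
  · simp only
    rw [mu_integral f hf hc, mu_integral f hf hc, ← (Equiv.addRight ((2 : ℤ) ^ k * m)).tsum_eq]
    have hrw : ∀ n : ℤ, ∫ u, f (x + 2 ^ k * m - (((Equiv.addRight ((2 : ℤ) ^ k * m)) n : ℤ)
        + phi ((Equiv.addRight ((2 : ℤ) ^ k * m)) n) u)) ∂P
        = ∫ u, f (x - (n + phi (n + 2 ^ k * m) u)) ∂P := by
      intro n
      congr 1
      ext u
      simp only [Equiv.coe_addRight]
      congr 1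
      push_cast
      ring
    simp_rw [hrw]
    have hz : ∀ (q : ℤ → ℤ), ∀ n ∉ Finset.Icc ⌈x - R - 1⌉ ⌊x + R⌋,
        ∫ u, f (x - (n + phi (q n) u)) ∂P = 0 := by
      intro q n hn
      refine integral_eq_zero_of_ae (Eventually.of_forall fun u => ?_)
      by_contra h
      have h3 := abs_le.1 (hR _ h)
      refine hn ?_
      have h1 := phi_nonneg (q n) u
      have h2 := phi_le (q n) u
      rw [Finset.mem_Icc, Int.ceil_le, Int.le_floor]
      constructor <;> linarith [h3.1, h3.2]
    rw [tsum_eq_sum (hz fun n => n + 2 ^ k * m), tsum_eq_sum (hz fun n => n),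
      ← Finset.sum_sub_distrib]
    have hint : ∀ (n j : ℤ), Integrable (fun u => f (x - (n + phi j u))) P := by
      intro n j
      obtain ⟨B, hB⟩ := hc.exists_bound_of_continuous hf
      refine Integrable.of_bound (C := B) ?_ (Eventually.of_forall fun u => hB _)
      exact (hf.measurable.comp (((phi_meas j).const_add _).const_sub _)).aestronglyMeasurable
    have hterm : ∀ n ∈ Finset.Icc ⌈x - R - 1⌉ ⌊x + R⌋,
        |∫ u, f (x - (n + phi (n + 2 ^ k * m) u)) ∂P - ∫ u, f (x - (n + phi n u)) ∂P|
          ≤ ε / C := by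
      intro n _
      rw [← integral_sub (hint _ _) (hint _ _), ← Real.norm_eq_abs]
      have := norm_integral_le_of_norm_le_const (μ := P) (C := ε / C)
        (f := fun u => f (x - (n + phi (n + 2 ^ k * m) u)) - f (x - (n + phi n u)))
        (Eventually.of_forall fun u => ?_)
      · simpa using this
      · rw [← dist_eq_norm]
        refine (huc ?_).le
        rw [Real.dist_eq]
        have := phi_ap k n m u
        rw [abs_sub_comm] at this
        refine lt_of_le_of_lt (le_of_eq ?_) (this.trans_lt hk)
        congr 1
        ring
    refine (Finset.abs_sum_le_sum_abs _ _).trans_lt ?_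
    refine (Finset.sum_le_card_nsmul _ _ _ hterm).trans_lt ?_
    rw [Int.card_Icc, nsmul_eq_mul]
    have hcard : (((⌊x + R⌋ + 1 - ⌈x - R - 1⌉).toNat : ℕ) : ℝ) < C := by
      rcases le_total 0 (⌊x + R⌋ + 1 - ⌈x - R - 1⌉) with h | h
      · have e : (((⌊x + R⌋ + 1 - ⌈x - R - 1⌉).toNat : ℤ) : ℝ)
            = ((⌊x + R⌋ + 1 - ⌈x - R - 1⌉ : ℤ) : ℝ) := by rw [Int.toNat_of_nonneg h]
        rw [Int.cast_natCast] at e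
        rw [e]
        push_cast
        have h1 := Int.floor_le (x + R)
        have h2 := Int.le_ceil (x - R - 1)
        linarith
      · rw [Int.toNat_of_nonpos h]; simpa using hC0
    calc _ < C * (ε / C) := mul_lt_mul_of_pos_right hcard (by positivity)
      _ = ε := by field_simp

end APConstr

/-- There exists a positive discrete translation bounded almost periodic Radon measure `μ`
on `ℝ` whose point masses tend to `0` at infinity; in particular `μ ≠ 2μ` although `μ` and
`2μ` are almost periodic, have the same support and their point masses come close at
infinity. -/
theorem exists_ap_measure_point_masses_to_zero :
    ∃ μ : Measure ℝ,
      -- translation bounded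
      (∃ M : ℝ≥0∞, M ≠ ⊤ ∧ ∀ t : ℝ, μ (Set.Icc t (t + 1)) ≤ M) ∧
      -- almost periodic: `f ⋆ μ` is Bohr almost periodic for every `f ∈ C_c(ℝ)`
      (∀ f : ℝ → ℝ, Continuous f → HasCompactSupport f →
        BohrAlmostPeriodic (fun x => ∫ y, f (x - y) ∂μ)) ∧
      -- discrete: `μ` is carried by a set `Λ` of isolated points, where it has
      -- nonzero point masses
      (∃ Λ : Set ℝ,
        μ ((Λ : Set ℝ)ᶜ) = 0 ∧
        (∀ l ∈ Λ, ∃ ε > (0 : ℝ), Λ ∩ Set.Ioo (l - ε) (l + ε) = {l}) ∧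
        (∀ l ∈ Λ, μ {l} ≠ 0)) ∧
      -- point masses tend to `0` at infinity
      Tendsto (fun x : ℝ => μ {x}) (cocompact ℝ) (nhds 0) ∧
      -- yet `μ ≠ 2μ`
      μ ≠ (2 : ℝ≥0∞) • μ := by
  exact ⟨APConstr.mu, ⟨3, by norm_num, APConstr.mu_bdd⟩, APConstr.mu_ap, APConstr.mu_discrete,
    APConstr.mu_tendsto, APConstr.mu_ne⟩
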